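/- Let X be a compact metric space, f : X → X a continuous map with the s-limit shadowing property, C a chain component of f and D ∈ 𝒟(C). Let ℱ, 𝒢 be full Furstenberg families compatible with (X^n, f^{×n}) for all n ≥ 2, with ℱ translation invariant. For any n ≥ 2 and δ > 0, if there is a δ-distal n-tuple (a_1,…,a_n) ∈ D^n for f (i.e., inf_{i≥0} min_{1≤j<k≤n} d(f^i(a_j), f^i(a_k)) > δ), then for every E ∈ 𝒟(C) and every 0 < r < δ, V^s(E) is generic (ℱ,𝒢)-n-r-chaotic for f. -/

import Mathlib

open Filter Metric Set Topology

section Defs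

variable {X : Type*} [MetricSpace X]

/-- A δ-chain of `f` of length `k` (with `k ≥ 1`) within the set `C`, from `x` to `y`. -/
def ChainIn (f : X → X) (C : Set X) (δ : ℝ) (k : ℕ) (x y : X) : Prop :=
  1 ≤ k ∧ ∃ c : ℕ → X, c 0 = x ∧ c k = y ∧ (∀ i ≤ k, c i ∈ C) ∧
    ∀ i < k, dist (f (c i)) (c (i + 1)) ≤ δ

/-- `x → y` : for every `δ > 0` there is a `δ`-chain of `f` from `x` to `y`. -/
def ChainReach (f : X → X) (x y : X) : Prop :=
  ∀ δ > 0, ∃ k, ChainIn f Set.univ δ k x y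

/-- `x` is chain recurrent for `f`. -/
def ChainRecurrent (f : X → X) (x : X) : Prop := ChainReach f x x

/-- `C` is a chain component of `f`: an equivalence class of the relation `↔`
on the set of chain recurrent points. -/
def IsChainComponent (f : X → X) (C : Set X) : Prop :=
  ∃ x, ChainRecurrent f x ∧
    C = {y | ChainRecurrent f y ∧ ChainReach f x y ∧ ChainReach f y x}

/-- The set of lengths of δ-cycles of `f` restricted to `C`. -/
def cycleLengths (f : X → X) (C : Set X) (δ : ℝ) : Set ℕ :=
  {k | ∃ x ∈ C, ChainIn f C δ k x x}

/-- The greatest common divisor of a set of natural numbers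
(the greatest natural number dividing every element). -/
noncomputable def setGcd (S : Set ℕ) : ℕ := sSup {d | ∀ k ∈ S, d ∣ k}

/-- `x ∼_{C,δ} y` : there is a δ-chain of `f|_C` from `x` to `y` whose length is
divisible by `m(C,δ)`, the gcd of the lengths of all δ-cycles of `f|_C`. -/
def SimCd (f : X → X) (C : Set X) (δ : ℝ) (x y : X) : Prop :=
  ∃ k, setGcd (cycleLengths f C δ) ∣ k ∧ ChainIn f C δ k x y

/-- `x ∼_C y` : `x ∼_{C,δ} y` for all `δ > 0`. -/
def SimC (f : X → X) (C : Set X) (x y : X) : Prop :=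
  ∀ δ > 0, SimCd f C δ x y

/-- `𝒟(C,δ)` : the set of equivalence classes of `∼_{C,δ}`. -/
def DClassesd (f : X → X) (C : Set X) (δ : ℝ) : Set (Set X) :=
  {D | ∃ x ∈ C, D = {y ∈ C | SimCd f C δ x y}}

/-- `𝒟(C)` : the set of equivalence classes of `∼_C`. -/
def DClasses (f : X → X) (C : Set X) : Set (Set X) :=
  {D | ∃ x ∈ C, D = {y ∈ C | SimC f C x y}}

/-- `W^s(C) = {x : lim_{i→∞} d(f^i(x), C) = 0}`. -/
def wStable (f : X → X) (C : Set X) : Set X :=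
  {x | Tendsto (fun i => infDist (f^[i] x) C) atTop (nhds 0)}

/-- `V^s(D) = ⋂_{δ>0} {x ∈ W^s(C) : lim_{i→∞} d(f^i(x), f^i(D_δ)) = 0}`, where
`D_δ` is the unique element of `𝒟(C,δ)` containing `D`. -/
def vStable (f : X → X) (C D : Set X) : Set X :=
  {x | x ∈ wStable f C ∧ ∀ δ > 0, ∀ Dd ∈ DClassesd f C δ, D ⊆ Dd →
    Tendsto (fun i => infDist (f^[i] x) (f^[i] '' Dd)) atTop (nhds 0)}

/-- The s-limit shadowing property. -/
def SLimitShadowing (f : X → X) : Prop :=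
  ∀ ε > 0, ∃ δ > 0, ∀ x : ℕ → X,
    (∀ i, dist (f (x i)) (x (i + 1)) ≤ δ) →
    Tendsto (fun i => dist (f (x i)) (x (i + 1))) atTop (nhds 0) →
    ∃ z : X, (∀ i, dist (f^[i] z) (x i) ≤ ε) ∧
      Tendsto (fun i => dist (f^[i] z) (x i)) atTop (nhds 0)

/-- The limit shadowing property. -/
def LimitShadowing (f : X → X) : Prop :=
  ∀ x : ℕ → X, Tendsto (fun i => dist (f (x i)) (x (i + 1))) atTop (nhds 0) →
    ∃ z : X, Tendsto (fun i => dist (f^[i] z) (x i)) atTop (nhds 0)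

/-- The (plain) shadowing property. -/
def ShadowingProperty (f : X → X) : Prop :=
  ∀ ε > 0, ∃ δ > 0, ∀ x : ℕ → X, (∀ i, dist (f (x i)) (x (i + 1)) ≤ δ) →
    ∃ z : X, ∀ i, dist (f^[i] z) (x i) ≤ ε

/-- A Furstenberg family: hereditary upward and proper. -/
def FurstenbergFamily (F : Set (Set ℕ)) : Prop :=
  (∀ A B : Set ℕ, A ∈ F → A ⊆ B → B ∈ F) ∧ F.Nonempty ∧ F ≠ Set.univ

/-- A full Furstenberg family. -/
def FullFamily (F : Set (Set ℕ)) : Prop :=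
  ∀ A ∈ F, ∀ n : ℕ, {i ∈ A | n ≤ i} ∈ F

/-- A translation invariant Furstenberg family. -/
def TranslationInvariantFamily (F : Set (Set ℕ)) : Prop :=
  ∀ A ∈ F, ∀ n : ℕ, ((fun i => i + n) '' A ∈ F ∧ {i | i + n ∈ A} ∈ F)

/-- `S_f(x₁,…,xₙ; r) = {i : min_{j<k} d(fⁱ(x_j), fⁱ(x_k)) > r}`. -/
def Sset (f : X → X) {n : ℕ} (x : Fin n → X) (r : ℝ) : Set ℕ :=
  {i | ∀ j k : Fin n, j < k → r < dist (f^[i] (x j)) (f^[i] (x k))}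

/-- `T_f(x₁,…,xₙ; r) = {i : max_{j<k} d(fⁱ(x_j), fⁱ(x_k)) < r}`. -/
def Tset (f : X → X) {n : ℕ} (x : Fin n → X) (r : ℝ) : Set ℕ :=
  {i | ∀ j k : Fin n, j < k → dist (f^[i] (x j)) (f^[i] (x k)) < r}

/-- `(x₁,…,xₙ)` is an `(ℱ,𝒢)`-δ-scrambled n-tuple for `f`. -/
def Scrambled (f : X → X) (F G : Set (Set ℕ)) (δ : ℝ) {n : ℕ} (x : Fin n → X) : Prop :=
  Sset f x δ ∈ F ∧ ∀ ε > 0, Tset f x ε ∈ G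

/-- `Y` is dense `(ℱ,𝒢)`-n-δ-chaotic for `f`: the `(ℱ,𝒢)`-δ-scrambled n-tuples in `Yⁿ`
form a dense subset of `Yⁿ`. -/
def DenseChaotic (f : X → X) (F G : Set (Set ℕ)) (n : ℕ) (δ : ℝ) (Y : Set X) : Prop :=
  {x : Fin n → X | ∀ j, x j ∈ Y} ⊆
    closure {x : Fin n → X | (∀ j, x j ∈ Y) ∧ Scrambled f F G δ x}

/-- `S` is a residual subset of the subspace `T`: it contains a countable intersection of
dense open subsets of `T`. -/
def ResidualIn {α : Type*} [TopologicalSpace α] (T S : Set α) : Prop :=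
  ∃ U : ℕ → Set α, (∀ i, IsOpen (U i)) ∧ (∀ i, T ⊆ closure (U i ∩ T)) ∧
    (⋂ i, U i) ∩ T ⊆ S

/-- `Y` is generic `(ℱ,𝒢)`-n-δ-chaotic for `f`: the `(ℱ,𝒢)`-δ-scrambled n-tuples in `Yⁿ`
form a residual subset of `Yⁿ`. -/
def GenericChaotic (f : X → X) (F G : Set (Set ℕ)) (n : ℕ) (δ : ℝ) (Y : Set X) : Prop :=
  ResidualIn {x : Fin n → X | ∀ j, x j ∈ Y}
    {x : Fin n → X | (∀ j, x j ∈ Y) ∧ Scrambled f F G δ x}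

/-- A Furstenberg family `F` is compatible with `(Z, g)`. -/
def CompatibleFamily {Z : Type*} [TopologicalSpace Z] (F : Set (Set ℕ)) (g : Z → Z) : Prop :=
  ∀ U : Set Z, IsOpen U → IsGδ {z | {i | g^[i] z ∈ U} ∈ F}

end Defs

section Chains

variable {X : Type*} [MetricSpace X] {f : X → X} {C : Set X} {δ : ℝ}

theorem ChainIn.trans {k l : ℕ} {x y z : X} (h₁ : ChainIn f C δ k x y)
    (h₂ : ChainIn f C δ l y z) : ChainIn f C δ (k + l) x z := by
  obtain ⟨hk, c, c0, ck, hc, hcd⟩ := h₁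
  obtain ⟨hl, e, e0, el, he, hed⟩ := h₂
  refine ⟨by omega, fun i => if i < k then c i else e (i - k), ?_, ?_, ?_, ?_⟩
  · simp [show 0 < k by omega, c0]
  · simp [el]
  · intro i hi
    by_cases h : i < k
    · simpa [h] using hc i h.le
    · simpa [h] using he (i - k) (by omega)
  · intro i hi
    by_cases h : i < k
    · by_cases h' : i + 1 < k
      · simpa [h, h'] using hcd i h
      · have hik : i + 1 = k := by omega
        simpa [h, hik, e0, ck] using hcd i h
    · have h' : ¬ i + 1 < k := by omega
      have hs : i + 1 - k = i - k + 1 := by omega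
      simpa [h, h', hs] using hed (i - k) (by omega)

theorem ChainIn.mono {δ' : ℝ} {C' : Set X} {k : ℕ} {x y : X} (h : ChainIn f C δ k x y)
    (hC : C ⊆ C') (hδ : δ ≤ δ') : ChainIn f C' δ' k x y := by
  obtain ⟨hk, c, c0, ck, hc, hcd⟩ := h
  exact ⟨hk, c, c0, ck, fun i hi => hC (hc i hi), fun i hi => (hcd i hi).trans hδ⟩

theorem chainIn_iterate (hδ : 0 ≤ δ) (hfC : MapsTo f C C) {x : X} (hx : x ∈ C) {k : ℕ}
    (hk : 1 ≤ k) : ChainIn f C δ k x (f^[k] x) :=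
  ⟨hk, fun i => f^[i] x, rfl, rfl, fun i _ => hfC.iterate i hx, fun i _ => by
    simpa [Function.iterate_succ_apply'] using hδ⟩

theorem chainIn_subchain {c : ℕ → X} {k i j : ℕ} (hij : i < j) (hjk : j ≤ k)
    (hc : ∀ i ≤ k, c i ∈ C) (hcd : ∀ i < k, dist (f (c i)) (c (i + 1)) ≤ δ) :
    ChainIn f C δ (j - i) (c i) (c j) := by
  refine ⟨by omega, fun t => c (i + t), rfl, ?_, fun t ht => hc _ (by omega),
    fun t ht => hcd _ (by omega)⟩
  simp [show i + (j - i) = j by omega]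

/-- The target of a chain can be moved at the cost of a larger error. -/
theorem ChainIn.perturb_right {γ : ℝ} {k : ℕ} {x b y : X} (h : ChainIn f C δ k x b)
    (hγ : 0 ≤ γ) (hy : y ∈ C) (hby : dist b y ≤ γ) : ChainIn f C (δ + γ) k x y := by
  obtain ⟨hk, c, c0, ck, hc, hcd⟩ := h
  refine ⟨hk, fun i => if i = k then y else c i, ?_, ?_, ?_, ?_⟩
  · simp [show 0 ≠ k by omega, c0]
  · simp
  · intro i hi
    by_cases h : i = k
    · simpa [h] using hy
    · simpa [h] using hc i hi
  · intro i hi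
    have h : i ≠ k := hi.ne
    by_cases h' : i + 1 = k
    · have := hcd i hi
      have h2 := dist_triangle (f (c i)) b y
      rw [h', ck] at this
      simp only [h, h', if_true, if_false]
      linarith
    · simp only [h, h', if_false]
      linarith [hcd i hi]

/-- The source of a chain can be moved at the cost of a larger error. -/
theorem ChainIn.perturb_left {γ : ℝ} {k : ℕ} {x a y : X} (h : ChainIn f C δ k a y)
    (hγ : 0 ≤ γ) (hx : x ∈ C) (hxa : dist (f x) (f a) ≤ γ) : ChainIn f C (δ + γ) k x y := by
  obtain ⟨hk, c, c0, ck, hc, hcd⟩ := h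
  refine ⟨hk, fun i => if i = 0 then x else c i, ?_, ?_, ?_, ?_⟩
  · simp
  · simp [show k ≠ 0 by omega, ck]
  · intro i hi
    by_cases h : i = 0
    · simpa [h] using hx
    · simpa [h] using hc i hi
  · intro i hi
    by_cases h : i = 0
    · subst h
      have := hcd 0 hi
      have h2 := dist_triangle (f x) (f a) (c (0 + 1))
      rw [c0] at this
      simp only [if_true, Nat.add_eq_zero_iff, one_ne_zero, and_false, if_false]
      linarith
    · simp only [h, Nat.add_eq_zero_iff, one_ne_zero, and_false, if_false]
      linarith [hcd i hi]

theorem ChainReach.trans {x y z : X} (h₁ : ChainReach f x y) (h₂ : ChainReach f y z) :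
    ChainReach f x z := fun δ hδ =>
  let ⟨_, hk⟩ := h₁ δ hδ
  let ⟨_, hl⟩ := h₂ δ hδ
  ⟨_, hk.trans hl⟩

theorem chainReach_apply (x : X) : ChainReach f x (f x) := fun _ hδ =>
  ⟨1, chainIn_iterate hδ.le (mapsTo_univ f _) (mem_univ x) le_rfl⟩

theorem IsChainComponent.exists_mem_iff (hC : IsChainComponent f C) :
    ∃ p, ∀ y, y ∈ C ↔ ChainReach f p y ∧ ChainReach f y p := by
  obtain ⟨p, -, rfl⟩ := hC
  exact ⟨p, fun y => ⟨fun h => h.2, fun h => ⟨h.2.trans h.1, h⟩⟩⟩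

theorem IsChainComponent.chainReach (hC : IsChainComponent f C) {x y : X} (hx : x ∈ C)
    (hy : y ∈ C) : ChainReach f x y := by
  obtain ⟨p, hp⟩ := IsChainComponent.exists_mem_iff hC
  exact ((hp x).1 hx).2.trans ((hp y).1 hy).1

theorem IsChainComponent.mem_of_reach (hC : IsChainComponent f C) {x y z : X} (hx : x ∈ C)
    (hy : y ∈ C) (hxz : ChainReach f x z) (hzy : ChainReach f z y) : z ∈ C := by
  obtain ⟨p, hp⟩ := IsChainComponent.exists_mem_iff hC
  exact (hp z).2 ⟨((hp x).1 hx).1.trans hxz, hzy.trans ((hp y).1 hy).2⟩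

section Compact

variable [CompactSpace X]

theorem exists_uniform_modulus (hf : Continuous f) {ε : ℝ} (hε : 0 < ε) :
    ∃ γ > 0, γ ≤ ε ∧ ∀ u v, dist u v ≤ γ → dist (f u) (f v) ≤ ε := by
  obtain ⟨γ, hγ, h⟩ := Metric.uniformContinuous_iff.1
    (CompactSpace.uniformContinuous_of_continuous hf) ε hε
  refine ⟨min (γ / 2) ε, by positivity, min_le_right _ _, fun u v huv => (h ?_).le⟩
  linarith [min_le_left (γ / 2) ε]

/-- Chain reachability is a closed condition. -/
theorem chainReach_of_approx (hf : Continuous f) {x y : X}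
    (h : ∀ γ > 0, ∃ a b k, dist x a ≤ γ ∧ dist b y ≤ γ ∧ ChainIn f Set.univ γ k a b) :
    ChainReach f x y := by
  intro δ hδ
  obtain ⟨γ, hγ, hγδ, hm⟩ := exists_uniform_modulus hf (show 0 < δ / 3 by positivity)
  obtain ⟨a, b, k, ha, hb, hk⟩ := h γ hγ
  refine ⟨k, ((hk.perturb_right hγ.le (mem_univ y) hb).perturb_left (by positivity)
    (mem_univ x) (hm _ _ ha)).mono Subset.rfl ?_⟩
  linarith

theorem chainReach_of_apply (hf : Continuous f) {x : X} (hx : ChainRecurrent f x) :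
    ChainReach f (f x) x := by
  refine chainReach_of_approx hf fun γ hγ => ?_
  obtain ⟨k, hk⟩ := hx γ hγ
  obtain ⟨hk2, c, c0, ck, hc, hcd⟩ := hk.trans hk
  have hk1 := hk.1
  refine ⟨c 1, c (k + k), _, ?_, ?_, chainIn_subchain (i := 1) (by omega) le_rfl hc hcd⟩
  · simpa [c0] using hcd 0 (by omega)
  · simp [ck, hγ.le]

theorem IsChainComponent.mapsTo (hf : Continuous f) (hC : IsChainComponent f C) :
    MapsTo f C C := fun x hx =>
  hC.mem_of_reach hx hx (chainReach_apply x)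
    (chainReach_of_apply hf (hC.chainReach hx hx))

theorem IsChainComponent.isClosed (hf : Continuous f) (hC : IsChainComponent f C) :
    IsClosed C := by
  refine isClosed_of_closure_subset fun x hx => ?_
  have happ := Metric.mem_closure_iff.1 hx
  obtain ⟨p, hp, -⟩ := happ 1 one_pos
  refine hC.mem_of_reach hp hp (chainReach_of_approx hf fun γ hγ => ?_)
    (chainReach_of_approx hf fun γ hγ => ?_)
  all_goals obtain ⟨y, hy, hxy⟩ := happ γ hγ
  · obtain ⟨k, hk⟩ := hC.chainReach hp hy γ hγ
    exact ⟨p, y, k, by simp [hγ.le], by rw [dist_comm]; exact hxy.le, hk⟩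
  · obtain ⟨k, hk⟩ := hC.chainReach hy hp γ hγ
    exact ⟨y, p, k, hxy.le, by simp [hγ.le], hk⟩

/-- Fine enough chains between two points of a chain component stay close to it. -/
theorem IsChainComponent.exists_chain_near (hf : Continuous f) (hC : IsChainComponent f C)
    {x y : X} (hx : x ∈ C) (hy : y ∈ C) {γ : ℝ} (hγ : 0 < γ) :
    ∃ δ > 0, δ ≤ γ ∧ ∀ (c : ℕ → X) (k : ℕ), c 0 = x → c k = y →
      (∀ i < k, dist (f (c i)) (c (i + 1)) ≤ δ) → ∀ i ≤ k, ∃ w ∈ C, dist (c i) w ≤ γ := by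
  by_contra! H
  have H' : ∀ n : ℕ, ∃ z : X, (∀ w ∈ C, γ < dist z w) ∧
      (∃ k, ChainIn f Set.univ (min γ (1 / (n + 1 : ℝ))) k x z) ∧
      ∃ k, ChainIn f Set.univ (min γ (1 / (n + 1 : ℝ))) k z y := by
    intro n
    obtain ⟨c, k, c0, ck, hcd, i, hik, hi⟩ := H (min γ (1 / (n + 1 : ℝ)))
      (lt_min hγ (by positivity)) (min_le_left _ _)
    have hi0 : i ≠ 0 := by
      rintro rfl
      have := hi x hx
      simp [c0] at this
      linarith
    have hik' : i ≠ k := by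
      rintro rfl
      have := hi y hy
      simp [ck] at this
      linarith
    refine ⟨c i, hi, ⟨i - 0, ?_⟩, ⟨k - i, ?_⟩⟩
    · rw [← c0]
      exact chainIn_subchain (i := 0) (by omega) hik (fun _ _ => mem_univ _) hcd
    · rw [← ck]
      exact chainIn_subchain (by omega) le_rfl (fun _ _ => mem_univ _) hcd
  choose z hz hxz hzy using H'
  obtain ⟨q, φ, hφ, hq⟩ := CompactSpace.tendsto_subseq z
  have key : ∀ ε > 0, ∃ n, dist (z n) q ≤ ε ∧ min γ (1 / (n + 1 : ℝ)) ≤ ε := by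
    intro ε hε
    have h1 := (Metric.tendsto_nhds.1 hq) ε hε
    have h2 := (Metric.tendsto_nhds.1
      ((tendsto_one_div_add_atTop_nhds_zero_nat (𝕜 := ℝ)).comp hφ.tendsto_atTop)) ε hε
    obtain ⟨n, hn1, hn2⟩ := (h1.and h2).exists
    refine ⟨φ n, hn1.le, (min_le_right _ _).trans ?_⟩
    rw [Real.dist_eq, sub_zero] at hn2
    exact (le_abs_self _).trans hn2.le
  have hqC : q ∈ C := by
    refine hC.mem_of_reach hx hy (chainReach_of_approx hf fun ε hε => ?_)
      (chainReach_of_approx hf fun ε hε => ?_)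
    all_goals obtain ⟨n, hn1, hn2⟩ := key ε hε
    · obtain ⟨k, hk⟩ := hxz n
      exact ⟨x, z n, k, by simp [hε.le], hn1, hk.mono Subset.rfl hn2⟩
    · obtain ⟨k, hk⟩ := hzy n
      exact ⟨z n, y, k, by rwa [dist_comm], by simp [hε.le], hk.mono Subset.rfl hn2⟩
  obtain ⟨n, hn, -⟩ := key γ hγ
  exact absurd (hz n q hqC) (not_lt.2 hn)

/-- The restriction of `f` to a chain component is chain transitive. -/
theorem IsChainComponent.exists_chainIn (hf : Continuous f) (hC : IsChainComponent f C)
    {x y : X} (hx : x ∈ C) (hy : y ∈ C) (hδ : 0 < δ) : ∃ k, ChainIn f C δ k x y := by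
  obtain ⟨γ, hγ, hγδ, hm⟩ := exists_uniform_modulus hf (show 0 < δ / 3 by positivity)
  obtain ⟨β, hβ, hβγ, hnear⟩ := hC.exists_chain_near hf hx hy hγ
  obtain ⟨k, hk, c, c0, ck, -, hcd⟩ := hC.chainReach hx hy β hβ
  have hw : ∀ i, ∃ w, i ≤ k → w ∈ C ∧ dist (c i) w ≤ γ ∧ (i = 0 ∨ i = k → w = c i) := by
    intro i
    by_cases hik : i ≤ k
    · by_cases he : i = 0 ∨ i = k
      · refine ⟨c i, fun _ => ⟨?_, by simp [hγ.le], fun _ => rfl⟩⟩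
        rcases he with rfl | rfl
        · rwa [c0]
        · rwa [ck]
      · obtain ⟨w, hw, hwd⟩ := hnear c k c0 ck hcd i hik
        exact ⟨w, fun _ => ⟨hw, hwd, fun h => absurd h he⟩⟩
    · exact ⟨c i, fun h => absurd h hik⟩
  choose w hw using hw
  refine ⟨k, hk, w, ?_, ?_, fun i hi => (hw i hi).1, fun i hi => ?_⟩
  · rw [(hw 0 (by omega)).2.2 (Or.inl rfl), c0]
  · rw [(hw k le_rfl).2.2 (Or.inr rfl), ck]
  · have h1 := hm _ _ (hw i hi.le).2.1
    have h2 := hcd i hi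
    have h3 := (hw (i + 1) hi).2.1
    have h4 := dist_triangle4 (f (w i)) (f (c i)) (c (i + 1)) (w (i + 1))
    rw [dist_comm] at h1
    linarith

end Compact

end Chains

section Classes

variable {X : Type*} [MetricSpace X] {f : X → X} {C : Set X} {δ : ℝ}

theorem setGcd_eq_natSetGcd {S : Set ℕ} (hS : ∃ k ∈ S, k ≠ 0) : setGcd S = Nat.setGcd S := by
  have h0 : Nat.setGcd S ≠ 0 := fun h => by
    obtain ⟨k, hk, hk0⟩ := hS
    exact hk0 (Nat.setGcd_eq_zero_iff.1 h hk)
  exact IsGreatest.csSup_eq ⟨fun k hk => Nat.setGcd_dvd_of_mem hk,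
    fun d hd => Nat.le_of_dvd (by omega) (Nat.dvd_setGcd_iff.2 hd)⟩

theorem ChainIn.source_mem {k : ℕ} {x y : X} (h : ChainIn f C δ k x y) : x ∈ C := by
  obtain ⟨-, c, rfl, -, hc, -⟩ := h
  exact hc 0 (Nat.zero_le _)

theorem ChainIn.target_mem {k : ℕ} {x y : X} (h : ChainIn f C δ k x y) : y ∈ C := by
  obtain ⟨-, c, -, rfl, hc, -⟩ := h
  exact hc k le_rfl

theorem ChainIn.mem_cycleLengths {k : ℕ} {x : X} (h : ChainIn f C δ k x x) :
    k ∈ cycleLengths f C δ := ⟨x, h.source_mem, h⟩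

theorem ChainIn.setGcd_eq {k : ℕ} {x : X} (h : ChainIn f C δ k x x) :
    setGcd (cycleLengths f C δ) = Nat.setGcd (cycleLengths f C δ) :=
  setGcd_eq_natSetGcd ⟨k, h.mem_cycleLengths, by have := h.1; omega⟩

theorem ChainIn.setGcd_dvd {k : ℕ} {x : X} (h : ChainIn f C δ k x x) :
    setGcd (cycleLengths f C δ) ∣ k :=
  h.setGcd_eq ▸ Nat.setGcd_dvd_of_mem h.mem_cycleLengths

theorem ChainIn.setGcd_pos {k : ℕ} {x : X} (h : ChainIn f C δ k x x) :
    0 < setGcd (cycleLengths f C δ) :=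
  Nat.pos_of_dvd_of_pos h.setGcd_dvd h.1

theorem ChainIn.setGcd_dvd_setGcd {δ' : ℝ} {k : ℕ} {x : X} (h : ChainIn f C δ' k x x)
    (hδ : δ' ≤ δ) : setGcd (cycleLengths f C δ) ∣ setGcd (cycleLengths f C δ') := by
  rw [h.setGcd_eq, (h.mono Subset.rfl hδ).setGcd_eq]
  exact Nat.setGcd_mono fun l ⟨y, hy, hl⟩ => ⟨y, hy, hl.mono Subset.rfl hδ⟩

theorem mem_vStable_of_asymptotic (hfC : MapsTo f C C) {E : Set X} (hEC : E ⊆ C) {b z : X}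
    (hb : b ∈ E) (h : Tendsto (fun i => dist (f^[i] z) (f^[i] b)) atTop (𝓝 0)) :
    z ∈ vStable f C E := by
  refine ⟨squeeze_zero (fun _ => infDist_nonneg)
    (fun i => infDist_le_dist_of_mem (hfC.iterate i (hEC hb))) h, fun δ _ Dd _ hD => ?_⟩
  exact squeeze_zero (fun _ => infDist_nonneg)
    (fun i => infDist_le_dist_of_mem (mem_image_of_mem _ (hD hb))) h

variable [CompactSpace X]

/-- A chain between two points of one class of `∼_{C,δ}` has length divisible by `m(C,δ)`. -/
theorem IsChainComponent.setGcd_dvd_of_chainIn (hf : Continuous f) (hC : IsChainComponent f C)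
    (hδ : 0 < δ) {x u v : X} {l : ℕ} (hu : SimCd f C δ x u) (hv : SimCd f C δ x v)
    (h : ChainIn f C δ l u v) : setGcd (cycleLengths f C δ) ∣ l := by
  obtain ⟨p, hp, cu⟩ := hu
  obtain ⟨q, hq, cv⟩ := hv
  obtain ⟨t, ct⟩ := hC.exists_chainIn hf cv.target_mem cv.source_mem hδ
  have ht := (Nat.dvd_add_right hq).1 (cv.trans ct).setGcd_dvd
  have h2 := (Nat.dvd_add_left ht).1 ((cu.trans h).trans ct).setGcd_dvd
  exact (Nat.dvd_add_right hp).1 h2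

/-- All large multiples of `m(C,δ)` are lengths of `δ`-cycles through a given point. -/
theorem IsChainComponent.exists_cycle_of_dvd (hf : Continuous f) (hC : IsChainComponent f C)
    (hδ : 0 < δ) {b : X} (hb : b ∈ C) :
    ∃ L₀, ∀ L ≥ L₀, setGcd (cycleLengths f C δ) ∣ L → ChainIn f C δ L b b := by
  set S : Set ℕ := {k | ChainIn f C δ k b b}
  obtain ⟨n, hn⟩ := Nat.exists_mem_closure_of_ge S
  have hdvd : Nat.setGcd S ∣ setGcd (cycleLengths f C δ) := by
    obtain ⟨k, hk⟩ := hC.exists_chainIn hf hb hb hδ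
    rw [hk.setGcd_eq, Nat.dvd_setGcd_iff]
    rintro l ⟨y, hy, hl⟩
    obtain ⟨p, hp⟩ := hC.exists_chainIn hf hb hy hδ
    obtain ⟨q, hq⟩ := hC.exists_chainIn hf hy hb hδ
    have h1 : Nat.setGcd S ∣ p + q := Nat.setGcd_dvd_of_mem (hp.trans hq)
    have h2 : Nat.setGcd S ∣ p + l + q := Nat.setGcd_dvd_of_mem ((hp.trans hl).trans hq)
    rw [add_right_comm] at h2
    exact (Nat.dvd_add_right h1).1 h2
  have hcl : ∀ L ∈ AddSubmonoid.closure S, L = 0 ∨ L ∈ S := by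
    intro L hL
    induction hL using AddSubmonoid.closure_induction with
    | mem x hx => exact Or.inr hx
    | zero => exact Or.inl rfl
    | add x y _ _ hx hy =>
      rcases hx with rfl | hx
      · simpa using hy
      · rcases hy with rfl | hy
        · exact Or.inr hx
        · exact Or.inr (ChainIn.trans hx hy)
  refine ⟨max n 1, fun L hL hm => ?_⟩
  rcases hcl L (hn L (le_of_max_le_left hL) (hdvd.trans hm)) with h | h
  · have := le_of_max_le_right hL
    omega
  · exact h

/-- A chain from the `N`-th iterate of a point equivalent to `b` can be timed so as to join the
orbit of `b` in phase. -/
theorem IsChainComponent.exists_chain_to_orbit (hf : Continuous f) (hC : IsChainComponent f C)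
    (hδ : 0 < δ) {x w b : X} (hw : SimCd f C δ x w) (hb : SimCd f C δ x b) (hwC : w ∈ C)
    (hbC : b ∈ C) {N : ℕ} (hN : 1 ≤ N) :
    ∃ l, ChainIn f C δ l (f^[N] w) (f^[N + l] b) := by
  have hfC := hC.mapsTo hf
  set m := setGcd (cycleLengths f C δ)
  obtain ⟨K, hK⟩ := hC.exists_chainIn hf (hfC.iterate N hwC) hbC hδ
  have hNK : m ∣ N + K :=
    hC.setGcd_dvd_of_chainIn hf hδ hw hb ((chainIn_iterate hδ.le hfC hwC hN).trans hK)
  obtain ⟨L₀, hL₀⟩ := hC.exists_cycle_of_dvd hf hδ hbC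
  have hm0 : 0 < m := by
    obtain ⟨k, hk⟩ := hC.exists_chainIn hf hbC hbC hδ
    exact hk.setGcd_pos
  obtain ⟨q, φ, hφ, hq⟩ := CompactSpace.tendsto_subseq fun i => f^[i * m] b
  obtain ⟨I, hI⟩ := Metric.cauchySeq_iff.1 hq.cauchySeq δ hδ
  set i₁ := φ (I + 1)
  set J := I + i₁ + L₀ + N + K
  set i₂ := φ J
  have hi₁1 : 1 ≤ i₁ := le_trans (by omega) (hφ.le_apply (x := I + 1))
  have hi₂J : J ≤ i₂ := hφ.le_apply
  have hd : dist (f^[i₁ * m] b) (f^[i₂ * m] b) < δ := hI _ (by omega) _ (by omega)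
  obtain ⟨j, hj⟩ := Nat.exists_eq_add_of_le (show i₁ + L₀ + N + K ≤ i₂ by omega)
  set R := (L₀ + N + K + j) * m - (N + K)
  have hle : L₀ + N + K + j ≤ (L₀ + N + K + j) * m := Nat.le_mul_of_pos_right _ hm0
  have hRc : ChainIn f C δ R b b :=
    hL₀ R (by omega) (Nat.dvd_sub (Dvd.intro_left _ rfl) hNK)
  have horb : ChainIn f C δ (i₁ * m) b (f^[i₂ * m] b) := by
    simpa using (chainIn_iterate le_rfl hfC hbC (Nat.mul_pos hi₁1 hm0)).perturb_right hδ.le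
      (hfC.iterate (i₂ * m) hbC) hd.le
  refine ⟨K + R + i₁ * m, ?_⟩
  have hlen : N + (K + R + i₁ * m) = i₂ * m := by
    have : i₂ * m = i₁ * m + (L₀ + N + K + j) * m := by rw [hj]; ring
    omega
  rw [hlen]
  exact (hK.trans hRc).trans horb

/-- Every point of `V^s(E)` is approximated by points asymptotic to a given `b ∈ E`. -/
theorem IsChainComponent.exists_asymptotic_near (hf : Continuous f) (hsls : SLimitShadowing f)
    (hC : IsChainComponent f C) {E : Set X} (hE : E ∈ DClasses f C) {x b : X}
    (hx : x ∈ vStable f C E) (hb : b ∈ E) {ε : ℝ} (hε : 0 < ε) :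
    ∃ z ∈ vStable f C E, dist z x ≤ ε ∧
      Tendsto (fun i => dist (f^[i] z) (f^[i] b)) atTop (𝓝 0) := by
  have hfC := hC.mapsTo hf
  obtain ⟨e, he, rfl⟩ := hE
  obtain ⟨η, hη, hsh⟩ := hsls ε hε
  have hne : {y ∈ C | SimCd f C η e y}.Nonempty := ⟨b, hb.1, hb.2 η hη⟩
  have hlim := hx.2 η hη {y ∈ C | SimCd f C η e y} ⟨e, he, rfl⟩
    fun y hy => ⟨hy.1, hy.2 η hη⟩
  obtain ⟨N, hNd, hN⟩ := ((hlim.eventually_lt_const hη).and (eventually_ge_atTop 1)).exists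
  obtain ⟨_, ⟨w, hw, rfl⟩, hxw⟩ := (infDist_lt_iff (hne.image _)).1 hNd
  obtain ⟨l, hl⟩ := hC.exists_chain_to_orbit hf hη hw.2 (hb.2 η hη) hw.1 hb.1 hN
  have hxc : ChainIn f Set.univ η N x (f^[N] w) := by
    simpa using (chainIn_iterate le_rfl (mapsTo_univ f _) (mem_univ x) hN).perturb_right hη.le
      (mem_univ _) hxw.le
  obtain ⟨hM, c, c0, cM, -, hcd⟩ := hxc.trans (hl.mono (subset_univ C) le_rfl)
  set M := N + l
  set ξ : ℕ → X := fun i => if i < M then c i else f^[i] b with hξ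
  have hξM : ∀ i, M ≤ i → ξ i = f^[i] b := fun i hi => by simp [hξ, not_lt.2 hi]
  have hξc : ∀ i, i ≤ M → ξ i = c i := fun i hi => by
    rcases hi.lt_or_eq with h | rfl
    · simp [hξ, h]
    · rw [hξM _ le_rfl, cM]
  have herr : ∀ i, M ≤ i → dist (f (ξ i)) (ξ (i + 1)) = 0 := fun i hi => by
    rw [hξM i hi, hξM (i + 1) (by omega), Function.iterate_succ_apply', dist_self]
  obtain ⟨z, hz, hzlim⟩ := hsh ξ
    (fun i => by
      rcases lt_or_ge i M with h | h
      · rw [hξc i h.le, hξc (i + 1) h]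
        exact hcd i h
      · rw [herr i h]
        exact hη.le)
    (tendsto_const_nhds.congr' (by
      filter_upwards [eventually_ge_atTop M] with i hi using (herr i hi).symm))
  have hzb : Tendsto (fun i => dist (f^[i] z) (f^[i] b)) atTop (𝓝 0) :=
    hzlim.congr' (by filter_upwards [eventually_ge_atTop M] with i hi using by rw [hξM i hi])
  refine ⟨z, mem_vStable_of_asymptotic hfC (fun y hy => hy.1) hb hzb, ?_, hzb⟩
  have := hz 0
  rwa [hξc 0 (Nat.zero_le _), c0] at this

/-- Any class of `∼_C` contains a limit of simultaneous iterates of a tuple in another class. -/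
theorem IsChainComponent.exists_limit_tuple (hf : Continuous f) (hC : IsChainComponent f C)
    {D E : Set X} (hD : D ∈ DClasses f C) (hE : E ∈ DClasses f C) {n : ℕ} {a : Fin n → X}
    (ha : ∀ j, a j ∈ D) : ∃ b : Fin n → X, (∀ j, b j ∈ E) ∧
      ∃ κ : ℕ → ℕ, Tendsto (fun i j => f^[κ i] (a j)) atTop (𝓝 b) := by
  have hfC := hC.mapsTo hf
  obtain ⟨d, hd, rfl⟩ := hD
  obtain ⟨e, he, rfl⟩ := hE
  have hk : ∀ i : ℕ, ∃ k, ∀ j, SimCd f C (1 / (i + 1 : ℝ)) e (f^[k] (a j)) := by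
    intro i
    have hi : (0 : ℝ) < 1 / (i + 1 : ℝ) := by positivity
    obtain ⟨k, hk⟩ := hC.exists_chainIn hf hd he hi
    obtain ⟨l, hl⟩ := hC.exists_chainIn hf he hd hi
    refine ⟨k, fun j => ?_⟩
    obtain ⟨p, hp, hpc⟩ := (ha j).2 _ hi
    refine ⟨l + p + k, ?_, (hl.trans hpc).trans (chainIn_iterate hi.le hfC (ha j).1 hk.1)⟩
    have := (hl.trans hk).setGcd_dvd
    rw [add_right_comm]
    exact dvd_add this hp
  choose k hk using hk
  obtain ⟨b, φ, hφ, hb⟩ := CompactSpace.tendsto_subseq fun i j => f^[k i] (a j)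
  have hbj : ∀ j, Tendsto (fun i => f^[k (φ i)] (a j)) atTop (𝓝 (b j)) :=
    fun j => (tendsto_pi_nhds.1 hb) j
  have hbC : ∀ j, b j ∈ C := fun j => (hC.isClosed hf).mem_of_tendsto (hbj j)
    (Eventually.of_forall fun i => hfC.iterate _ (ha j).1)
  refine ⟨b, fun j => ⟨hbC j, fun δ hδ => ?_⟩, k ∘ φ, hb⟩
  have h1 := (Metric.tendsto_nhds.1 (hbj j)) (δ / 2) (by positivity)
  have h2 := ((tendsto_one_div_add_atTop_nhds_zero_nat (𝕜 := ℝ)).comp hφ.tendsto_atTop).eventually_lt_const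
    (show (0 : ℝ) < δ / 2 by positivity)
  obtain ⟨i, hi1, hi2⟩ := (h1.and h2).exists
  simp only [Function.comp_apply] at hi2
  obtain ⟨l, hl, hlc⟩ := hk (φ i) j
  obtain ⟨t, ht⟩ := hC.exists_chainIn hf he he (show (0 : ℝ) < 1 / (φ i + 1 : ℝ) by positivity)
  refine ⟨l, (ht.setGcd_dvd_setGcd (by linarith)).trans hl,
    (hlc.perturb_right (by positivity) (hbC j) hi1.le).mono Subset.rfl (by linarith)⟩

end Classes

theorem residualIn_of_isGδ {α : Type*} [TopologicalSpace α] {T S : Set α} {P : ℕ → Set α}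
    (hP : ∀ i, IsGδ (P i)) (hd : ∀ i, T ⊆ closure (P i ∩ T)) (hS : (⋂ i, P i) ∩ T ⊆ S) :
    ResidualIn T S := by
  choose U hUo hU using fun i => (hP i).eq_iInter_nat
  refine ⟨fun t => U t.unpair.1 t.unpair.2, fun t => hUo _ _, fun t => (hd t.unpair.1).trans
    (closure_mono (inter_subset_inter_left _ ?_)), fun x hx => hS ⟨?_, hx.2⟩⟩
  · rw [hU t.unpair.1]
    exact iInter_subset _ _
  · refine mem_iInter.2 fun i => ?_
    rw [hU i]
    refine mem_iInter.2 fun j => ?_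
    simpa using mem_iInter.1 hx.1 (Nat.pair i j)

theorem iterate_pi_apply {X : Type*} (f : X → X) {n : ℕ} (x : Fin n → X) (i : ℕ) :
    (fun (y : Fin n → X) j => f (y j))^[i] x = fun j => f^[i] (x j) := by
  induction i with
  | zero => rfl
  | succ i ih => simp only [Function.iterate_succ_apply', ih]

theorem FullFamily.mem_of_eventually {F : Set (Set ℕ)} (hF : FurstenbergFamily F)
    (hfull : FullFamily F) {A : Set ℕ} (hA : ∀ᶠ i in atTop, i ∈ A) : A ∈ F := by
  obtain ⟨B, hB⟩ := hF.2.1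
  obtain ⟨N, hN⟩ := eventually_atTop.1 hA
  exact hF.1 _ _ (hfull B hB N) fun i hi => hN i hi.2

section Scrambling

variable {X : Type*} [MetricSpace X] {f : X → X} {n : ℕ}

theorem isGδ_sset {F : Set (Set ℕ)}
    (hF : CompatibleFamily F (fun x : Fin n → X => fun j => f (x j))) (r : ℝ) :
    IsGδ {x : Fin n → X | Sset f x r ∈ F} := by
  have h := hF {y | ∀ j k : Fin n, j < k → r < dist (y j) (y k)} (by
    simp only [ofPred_forall]
    refine isOpen_iInter_of_finite fun j => isOpen_iInter_of_finite fun k =>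
      isOpen_iInter_of_finite fun _ => isOpen_lt continuous_const ?_
    fun_prop)
  simp only [iterate_pi_apply] at h
  exact h

theorem isGδ_tset {G : Set (Set ℕ)}
    (hG : CompatibleFamily G (fun x : Fin n → X => fun j => f (x j))) (r : ℝ) :
    IsGδ {x : Fin n → X | Tset f x r ∈ G} := by
  have h := hG {y | ∀ j k : Fin n, j < k → dist (y j) (y k) < r} (by
    simp only [ofPred_forall]
    refine isOpen_iInter_of_finite fun j => isOpen_iInter_of_finite fun k =>
      isOpen_iInter_of_finite fun _ => isOpen_lt ?_ continuous_const
    fun_prop)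
  simp only [iterate_pi_apply] at h
  exact h

theorem sset_mem_of_asymptotic {F : Set (Set ℕ)} (hF : FurstenbergFamily F)
    (hfull : FullFamily F) {y b : Fin n → X} {r c : ℝ} (hrc : r < c)
    (hb : ∀ i, ∀ j k : Fin n, j < k → c ≤ dist (f^[i] (b j)) (f^[i] (b k)))
    (h : ∀ j, Tendsto (fun i => dist (f^[i] (y j)) (f^[i] (b j))) atTop (𝓝 0)) :
    Sset f y r ∈ F := by
  refine hfull.mem_of_eventually hF ?_
  have hev : ∀ᶠ i in atTop, ∀ j, dist (f^[i] (y j)) (f^[i] (b j)) < (c - r) / 2 :=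
    eventually_all.2 fun j => (h j).eventually_lt_const (by linarith)
  filter_upwards [hev] with i hi j k hjk
  have h1 := dist_triangle4 (f^[i] (b j)) (f^[i] (y j)) (f^[i] (y k)) (f^[i] (b k))
  have h2 := hi j
  rw [dist_comm] at h2
  linarith [hi k, hb i j k hjk]

theorem tset_mem_of_asymptotic {G : Set (Set ℕ)} (hG : FurstenbergFamily G)
    (hfull : FullFamily G) {y : Fin n → X} {b : X} {r : ℝ} (hr : 0 < r)
    (h : ∀ j, Tendsto (fun i => dist (f^[i] (y j)) (f^[i] b)) atTop (𝓝 0)) :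
    Tset f y r ∈ G := by
  refine hfull.mem_of_eventually hG ?_
  have hev : ∀ᶠ i in atTop, ∀ j, dist (f^[i] (y j)) (f^[i] b) < r / 2 :=
    eventually_all.2 fun j => (h j).eventually_lt_const (by linarith)
  filter_upwards [hev] with i hi j k hjk
  have h1 := dist_triangle_right (f^[i] (y j)) (f^[i] (y k)) (f^[i] b)
  linarith [hi j, hi k]

/-- Tuples of `V^s(E)` asymptotic to a given tuple of `E` are dense. -/
theorem IsChainComponent.dense_of_asymptotic [CompactSpace X] {C : Set X} (hf : Continuous f)
    (hsls : SLimitShadowing f) (hC : IsChainComponent f C) {E : Set X} (hE : E ∈ DClasses f C)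
    {b : Fin n → X} (hb : ∀ j, b j ∈ E) {P : Set (Fin n → X)}
    (hP : ∀ y : Fin n → X,
      (∀ j, Tendsto (fun i => dist (f^[i] (y j)) (f^[i] (b j))) atTop (𝓝 0)) → y ∈ P) :
    {x : Fin n → X | ∀ j, x j ∈ vStable f C E} ⊆
      closure (P ∩ {x : Fin n → X | ∀ j, x j ∈ vStable f C E}) := by
  intro x hx
  refine Metric.mem_closure_iff.2 fun ε hε => ?_
  choose y hyV hyx hyb using fun j =>
    hC.exists_asymptotic_near hf hsls hE (hx j) (hb j) (half_pos hε)
  refine ⟨y, ⟨hP y hyb, hyV⟩, ?_⟩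
  rw [dist_comm]
  exact ((dist_pi_le_iff (half_pos hε).le).2 hyx).trans_lt (half_lt_self hε)

end Scrambling

/-- Corollary 1.2: under s-limit shadowing, compatibility of `ℱ, 𝒢` and
translation invariance of `ℱ`, a δ-distal n-tuple in `Dⁿ` yields generic
`(ℱ,𝒢)`-n-r-chaos of `V^s(E)` for all `E ∈ 𝒟(C)` and `0 < r < δ`. -/
theorem generic_chaos_of_distal_tuple
    {X : Type*} [MetricSpace X] [CompactSpace X]
    (f : X → X) (hf : Continuous f) (hsls : SLimitShadowing f)
    (C : Set X) (hC : IsChainComponent f C) (D : Set X) (hD : D ∈ DClasses f C)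
    (F G : Set (Set ℕ)) (hF : FurstenbergFamily F) (hFfull : FullFamily F)
    (hG : FurstenbergFamily G) (hGfull : FullFamily G)
    (hFcomp : ∀ m : ℕ, 2 ≤ m → CompatibleFamily F (fun x : Fin m → X => fun j => f (x j)))
    (hGcomp : ∀ m : ℕ, 2 ≤ m → CompatibleFamily G (fun x : Fin m → X => fun j => f (x j)))
    (hFtr : TranslationInvariantFamily F)
    (n : ℕ) (hn : 2 ≤ n) (δ : ℝ) (hδ : 0 < δ)
    (a : Fin n → X) (haD : ∀ j, a j ∈ D)
    (hdistal : ∃ c : ℝ, δ < c ∧ ∀ i : ℕ, ∀ j k : Fin n, j < k →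
      c ≤ dist (f^[i] (a j)) (f^[i] (a k))) :
    ∀ E ∈ DClasses f C, ∀ r : ℝ, 0 < r → r < δ →
      GenericChaotic f F G n r (vStable f C E) := by
  intro E hE r _ hrδ
  obtain ⟨c, hδc, hc⟩ := hdistal
  obtain ⟨b, hbE, κ, hκ⟩ := hC.exists_limit_tuple hf hD hE haD
  have hbdist : ∀ i, ∀ j k : Fin n, j < k → c ≤ dist (f^[i] (b j)) (f^[i] (b k)) := by
    intro i j k hjk
    have hlim : ∀ j, Tendsto (fun t => f^[i] (f^[κ t] (a j))) atTop (𝓝 (f^[i] (b j))) :=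
      fun j => ((hf.iterate i).tendsto (b j)).comp ((tendsto_pi_nhds.1 hκ) j)
    refine ge_of_tendsto' ((hlim j).dist (hlim k)) fun t => ?_
    simpa only [Function.iterate_add_apply] using hc (i + κ t) j k hjk
  have hb₀ := hbE ⟨0, by omega⟩
  refine residualIn_of_isGδ (P := fun t => Nat.casesOn t {x : Fin n → X | Sset f x r ∈ F}
    fun t => {x : Fin n → X | Tset f x (1 / (t + 1 : ℝ)) ∈ G}) ?_ ?_ ?_
  · rintro (_ | t)
    exacts [isGδ_sset (hFcomp n hn) r, isGδ_tset (hGcomp n hn) _]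
  · rintro (_ | t)
    · exact hC.dense_of_asymptotic hf hsls hE hbE fun y hy =>
        sset_mem_of_asymptotic hF hFfull (hrδ.trans hδc) hbdist hy
    · exact hC.dense_of_asymptotic hf hsls hE (fun _ => hb₀) fun y hy =>
        tset_mem_of_asymptotic hG hGfull (by positivity) hy
  · rintro x ⟨hx, hxV⟩
    rw [mem_iInter] at hx
    refine ⟨hxV, hx 0, fun ε hε => ?_⟩
    obtain ⟨t, ht⟩ := exists_nat_one_div_lt hε
    exact hG.1 _ _ (hx (t + 1)) fun i hi j k hjk => (hi j k hjk).trans ht
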